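/- Monotonicity of the ratio z in both arguments: let M ∈ 𝓜^sh and let A, A', B, B' be Borel sets of finite unit partition number with A ⊆ A', B ⊆ B', A ∩ B = A ∩ B', and Z(B, M) > 0 and Z(B', M) > 0. Then z(A, B) := Z(A ∪ B, M)/Z(B, M) ≥ Z(A' ∪ B', M)/Z(B', M) =: z(A', B'). -/

import Mathlib

open MeasureTheory Metric

/-- Indicator of 1-hard-core tuples: `1` iff all pairs of distinct coordinates are at
distance at least one. (`h_0 = 1` by the empty quantification.) -/
noncomputable def hardCore {X : Type*} [MetricSpace X] (n : ℕ) (x : Fin n → X) : ℝ :=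
  if ∀ i j : Fin n, i ≠ j → 1 ≤ dist (x i) (x j) then 1 else 0

/-- The generating function `Z(B, M)` of weighted 1-hard-core configurations. -/
noncomputable def genZ {X : Type*} [MetricSpace X] [MeasurableSpace X]
    (B : Set X) (M : Measure X) : ℝ :=
  ∑' n : ℕ, ((-1 : ℝ) ^ n / n.factorial) *
    ∫ x in (Set.univ.pi fun _ : Fin n => B), hardCore n x ∂(Measure.pi fun _ : Fin n => M)

/-- The unit partition number `κ(B)`: the least `k` such that `B` is a disjoint union of
`k` Borel sets of diameter less than one (`⊤` if there is no such finite partition). -/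
noncomputable def kappa {X : Type*} [MetricSpace X] [MeasurableSpace X] (B : Set X) : ℕ∞ :=
  sInf {k : ℕ∞ | ∃ m : ℕ, k = (m : ℕ∞) ∧ ∃ A : Fin m → Set X,
    (∀ i, MeasurableSet (A i)) ∧ (∀ i, EMetric.diam (A i) < 1) ∧
    Pairwise (Function.onFun Disjoint A) ∧ B = ⋃ i, A i}

section Aux

variable {X : Type*} [MetricSpace X]

lemma hardCore_nonneg (n : ℕ) (x : Fin n → X) : 0 ≤ hardCore n x := by
  unfold hardCore; split_ifs <;> norm_num

lemma hardCore_le_one (n : ℕ) (x : Fin n → X) : hardCore n x ≤ 1 := by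
  unfold hardCore; split_ifs <;> norm_num

/-- Inserting a point `y` into a tuple keeps the tuple hard-core iff the tuple is hard-core and
avoids the open unit ball around `y`. -/
lemma hardCore_insertNth {n : ℕ} (i : Fin (n + 1)) (y : X) (x : Fin n → X) :
    hardCore (n + 1) (i.insertNth y x) =
      (Set.univ.pi fun _ : Fin n => (ball y 1)ᶜ).indicator (hardCore n) x := by
  have key : (∀ j k : Fin (n + 1), j ≠ k →
      1 ≤ dist ((i.insertNth y x : Fin (n + 1) → X) j) ((i.insertNth y x : Fin (n + 1) → X) k)) ↔
      (∀ j, 1 ≤ dist (x j) y) ∧ ∀ j k : Fin n, j ≠ k → 1 ≤ dist (x j) (x k) := by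
    constructor
    · intro h
      refine ⟨fun j => ?_, fun j k hjk => ?_⟩
      · simpa using h (i.succAbove j) i (Fin.succAbove_ne i j)
      · simpa using h (i.succAbove j) (i.succAbove k) (by simpa using hjk)
    · rintro ⟨h1, h2⟩ j k hjk
      rcases Fin.eq_self_or_eq_succAbove i j with hj | ⟨j, rfl⟩ <;>
        rcases Fin.eq_self_or_eq_succAbove i k with hk | ⟨k, rfl⟩
      · exact absurd (hj.trans hk.symm) hjk
      · subst hj; simpa [dist_comm] using h1 k
      · subst hk; simpa using h1 j
      · simpa using h2 j k (by simpa using hjk)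
  by_cases hx : ∀ j, 1 ≤ dist (x j) y
  · rw [Set.indicator_of_mem (by simpa [Set.mem_pi] using hx)]
    simp only [hardCore, key, hx, implies_true, true_and]
  · rw [Set.indicator_of_notMem (by simpa [Set.mem_pi] using hx), hardCore, if_neg]
    rw [key]; tauto

lemma hardCore_indicator_union {A E : Set X} (hdiam : ∀ x ∈ A, ∀ y ∈ A, dist x y < 1)
    (hAE : Disjoint A E) {n : ℕ} (x : Fin (n + 1) → X) :
    (Set.univ.pi fun _ : Fin (n + 1) => A ∪ E).indicator (hardCore (n + 1)) x =
      (Set.univ.pi fun _ : Fin (n + 1) => E).indicator (hardCore (n + 1)) x +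
      ∑ i : Fin (n + 1), {x : Fin (n + 1) → X | x i ∈ A ∧ ∀ j, x (i.succAbove j) ∈ E}.indicator
        (hardCore (n + 1)) x := by
  by_cases hc : ∀ i j : Fin (n + 1), i ≠ j → 1 ≤ dist (x i) (x j)
  swap
  · have : hardCore (n + 1) x = 0 := if_neg hc
    simp [Set.indicator, this]
  have hE : ∀ {i}, x i ∈ A → x i ∉ E := fun h h' => Set.disjoint_left.1 hAE h h'
  by_cases hx : ∃ i, x i ∈ A
  · obtain ⟨i, hi⟩ := hx
    have huniq : ∀ j, x j ∈ A → j = i := fun j hj => by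
      by_contra hne
      exact absurd (hdiam _ hj _ hi) (not_lt.2 (hc j i hne))
    rw [Set.indicator_of_notMem (s := Set.univ.pi fun _ : Fin (n + 1) => E)
        (fun h => hE hi (h i trivial)), zero_add,
      Finset.sum_eq_single i
        (fun j _ hj => Set.indicator_of_notMem (fun h => hj (huniq j h.1)) _) (by simp)]
    refine Set.indicator_eq_indicator ?_ rfl
    simp only [Set.mem_pi, Set.mem_univ, true_implies, Set.mem_union, Set.mem_ofPred_eq]
    refine ⟨fun h => ⟨hi, fun j => (h _).resolve_left fun h' =>
      Fin.succAbove_ne i j (huniq _ h')⟩, fun h j => ?_⟩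
    rcases Fin.eq_self_or_eq_succAbove i j with rfl | ⟨j, rfl⟩
    exacts [Or.inl hi, Or.inr (h.2 j)]
  · push Not at hx
    rw [Finset.sum_eq_zero fun i _ => Set.indicator_of_notMem (fun h => hx i h.1) _, add_zero]
    refine Set.indicator_eq_indicator ?_ rfl
    simp [Set.mem_pi, hx]

variable [MeasurableSpace X]

lemma measurable_hardCore [BorelSpace X] [SecondCountableTopology X] (n : ℕ) :
    Measurable (hardCore n : (Fin n → X) → ℝ) := by
  unfold hardCore
  refine Measurable.ite ?_ measurable_const measurable_const
  simp only [Set.ofPred_forall]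
  refine MeasurableSet.iInter fun i => MeasurableSet.iInter fun j => MeasurableSet.iInter fun _ => ?_
  exact measurableSet_le measurable_const ((measurable_pi_apply i).dist (measurable_pi_apply j))

/-- The weight of hard-core `n`-tuples in `B`. -/
noncomputable def hardCoreWeight (M : Measure X) (n : ℕ) (B : Set X) : ℝ :=
  ∫ x in (Set.univ.pi fun _ : Fin n => B), hardCore n x ∂(Measure.pi fun _ : Fin n => M)

lemma hardCoreWeight_nonneg (M : Measure X) (n : ℕ) (B : Set X) : 0 ≤ hardCoreWeight M n B :=
  integral_nonneg fun _ => hardCore_nonneg _ _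

lemma measurableSet_pi_diff_ball [BorelSpace X] {E : Set X} (hE : MeasurableSet E) (n : ℕ) (y : X) :
    MeasurableSet (Set.univ.pi fun _ : Fin n => E \ ball y 1) :=
  MeasurableSet.univ_pi fun _ => hE.diff measurableSet_ball

lemma integral_avoiding [BorelSpace X] (M : Measure X) {A E : Set X} (hE : MeasurableSet E) (n : ℕ) (y : X) :
    ∫ x, A.indicator 1 y * (Set.univ.pi fun _ : Fin n => E \ ball y 1).indicator (hardCore n) x
      ∂(Measure.pi fun _ : Fin n => M) =
    A.indicator (fun y => hardCoreWeight M n (E \ ball y 1)) y := by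
  rw [integral_const_mul, integral_indicator (measurableSet_pi_diff_ball hE n y)]
  by_cases hy : y ∈ A <;> simp [hy, hardCoreWeight]

lemma hardCoreWeight_restrict (M : Measure X) [SigmaFinite M] (n : ℕ) {B : Set X} (W : Set X)
    (hB : MeasurableSet B) : hardCoreWeight (M.restrict W) n B = hardCoreWeight M n (B ∩ W) := by
  simp only [hardCoreWeight, Measure.restrict_pi_pi, Measure.restrict_restrict hB]

lemma genZ_restrict (M : Measure X) [SigmaFinite M] {B : Set X} (W : Set X)
    (hB : MeasurableSet B) : genZ B (M.restrict W) = genZ (B ∩ W) M :=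
  tsum_congr fun n => congrArg _ (hardCoreWeight_restrict M n W hB)

section Finite

variable [BorelSpace X] [SecondCountableTopology X] (M : Measure X) [IsFiniteMeasure M]

lemma integrable_of_bounded {Y : Type*} [MeasurableSpace Y] {μ : Measure Y} [IsFiniteMeasure μ]
    {f : Y → ℝ} (hf : Measurable f) (h0 : ∀ y, 0 ≤ f y) (h1 : ∀ y, f y ≤ 1) : Integrable f μ :=
  Integrable.of_bound hf.aestronglyMeasurable 1
    (Filter.Eventually.of_forall fun y => by rw [Real.norm_of_nonneg (h0 y)]; exact h1 y)

lemma hardCoreWeight_le (n : ℕ) (B : Set X) :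
    hardCoreWeight M n B ≤ M.real Set.univ ^ n := by
  calc hardCoreWeight M n B
      ≤ ∫ x, hardCore n x ∂(Measure.pi fun _ : Fin n => M) :=
        setIntegral_le_integral
          (integrable_of_bounded (measurable_hardCore n) (hardCore_nonneg n) (hardCore_le_one n))
          (Filter.Eventually.of_forall (hardCore_nonneg n))
    _ ≤ ∫ _, (1 : ℝ) ∂(Measure.pi fun _ : Fin n => M) :=
        integral_mono
          (integrable_of_bounded (measurable_hardCore n) (hardCore_nonneg n) (hardCore_le_one n))
          (integrable_const _) (hardCore_le_one n)
    _ = M.real Set.univ ^ n := by simp [measureReal_def, Measure.pi_univ]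

lemma norm_term_le (n : ℕ) (B : Set X) :
    ‖(-1 : ℝ) ^ n / n.factorial * hardCoreWeight M n B‖ ≤ M.real Set.univ ^ n / n.factorial := by
  rw [norm_mul, norm_div, norm_pow, norm_neg, norm_one, one_pow,
    Real.norm_of_nonneg (hardCoreWeight_nonneg M n B), RCLike.norm_natCast, div_mul_eq_mul_div, one_mul]
  gcongr
  exact hardCoreWeight_le M n B

lemma hasSum_genZ (B : Set X) :
    HasSum (fun n : ℕ => (-1 : ℝ) ^ n / n.factorial * hardCoreWeight M n B) (genZ B M) :=
  (Summable.of_norm_bounded (Real.summable_pow_div_factorial _) (norm_term_le M · B)).hasSum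

lemma measurable_indicator_avoiding {A E : Set X} (hA : MeasurableSet A) (hE : MeasurableSet E)
    (n : ℕ) : Measurable fun p : X × (Fin n → X) =>
      A.indicator 1 p.1 * (Set.univ.pi fun _ : Fin n => E \ ball p.1 1).indicator (hardCore n) p.2 := by
  refine ((measurable_one.indicator hA).comp measurable_fst).mul ?_
  have : (fun p : X × (Fin n → X) =>
      (Set.univ.pi fun _ : Fin n => E \ ball p.1 1).indicator (hardCore n) p.2) =
      {p : X × (Fin n → X) | ∀ i, p.2 i ∈ E ∧ 1 ≤ dist (p.2 i) p.1}.indicator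
        (fun p => hardCore n p.2) := by
    ext p
    refine Set.indicator_eq_indicator ?_ rfl
    simp [Set.mem_pi]
  rw [this]
  refine ((measurable_hardCore n).comp measurable_snd).indicator ?_
  rw [Set.ofPred_forall]
  refine MeasurableSet.iInter fun i => ?_
  have hi : Measurable fun p : X × (Fin n → X) => p.2 i :=
    (measurable_pi_apply i).comp measurable_snd
  exact (hi hE).inter (measurableSet_le measurable_const (hi.dist measurable_fst))

lemma integrable_avoiding {A E : Set X} (hA : MeasurableSet A) (hE : MeasurableSet E) (n : ℕ) :
    Integrable (fun p : X × (Fin n → X) =>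
      A.indicator 1 p.1 * (Set.univ.pi fun _ : Fin n => E \ ball p.1 1).indicator (hardCore n) p.2)
      (M.prod (Measure.pi fun _ : Fin n => M)) := by
  refine integrable_of_bounded (measurable_indicator_avoiding hA hE n) (fun p => ?_) fun p => ?_
  · exact mul_nonneg (Set.indicator_nonneg (by simp) _)
      (Set.indicator_nonneg (fun _ _ => hardCore_nonneg _ _) _)
  · refine mul_le_one₀ (Set.indicator_le_self' (by simp) _)
      (Set.indicator_nonneg (fun _ _ => hardCore_nonneg _ _) _) ?_
    exact Set.indicator_apply_le' (fun _ => hardCore_le_one _ _) (by simp)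

lemma integrableOn_hardCoreWeight_avoiding {A E : Set X} (hA : MeasurableSet A)
    (hE : MeasurableSet E) (n : ℕ) :
    IntegrableOn (fun y => hardCoreWeight M n (E \ ball y 1)) A M := by
  have h := (integrable_avoiding M hA hE n).integral_prod_left
  simp only [integral_avoiding M hE n] at h
  exact (integrable_indicator_iff hA).1 h

/-- The weight of hard-core tuples whose `i`-th point lies in `A` and whose other points
lie in `E`. -/
lemma setIntegral_hardCore_insertNth {A E : Set X} (hA : MeasurableSet A) (hE : MeasurableSet E)
    {n : ℕ} (i : Fin (n + 1)) :
    ∫ x, {x : Fin (n + 1) → X | x i ∈ A ∧ ∀ j, x (i.succAbove j) ∈ E}.indicator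
        (hardCore (n + 1)) x ∂(Measure.pi fun _ : Fin (n + 1) => M) =
      ∫ y in A, hardCoreWeight M n (E \ ball y 1) ∂M := by
  have hmp := (measurePreserving_piFinSuccAbove (fun _ : Fin (n + 1) => M) i).symm
  rw [← hmp.integral_comp (MeasurableEquiv.measurableEmbedding _), ← integral_indicator hA]
  simp only [← integral_avoiding M hE n]
  rw [← integral_prod _ (integrable_avoiding M hA hE n)]
  refine integral_congr_ae (Filter.Eventually.of_forall fun p => ?_)
  obtain ⟨y, x⟩ := p
  have hv : (MeasurableEquiv.piFinSuccAbove (fun _ : Fin (n + 1) => X) i).symm (y, x) =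
    i.insertNth y x := rfl
  simp only [hv]
  have hc := hardCore_insertNth i y x
  by_cases hy : y ∈ A
  · by_cases hx : ∀ j, x j ∈ E
    · rw [Set.indicator_of_mem (by simpa using ⟨hy, hx⟩), hc]
      simp [Set.indicator, hy, Set.mem_pi, hx]
    · rw [Set.indicator_of_notMem (by simpa using fun _ => not_forall.1 hx),
        Set.indicator_of_notMem (s := Set.univ.pi _)]
      · simp
      · simp only [Set.mem_pi, Set.mem_univ, true_implies, Set.mem_sdiff]
        exact fun h => hx fun j => (h j).1
  · rw [Set.indicator_of_notMem (by simp [hy])]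
    simp [hy]

lemma hardCoreWeight_union_succ {A E : Set X} (hA : MeasurableSet A) (hE : MeasurableSet E)
    (hdiam : ∀ x ∈ A, ∀ y ∈ A, dist x y < 1) (hAE : Disjoint A E) (n : ℕ) :
    hardCoreWeight M (n + 1) (A ∪ E) = hardCoreWeight M (n + 1) E +
      (n + 1) * ∫ y in A, hardCoreWeight M n (E \ ball y 1) ∂M := by
  have hint : Integrable (hardCore (n + 1)) (Measure.pi fun _ : Fin (n + 1) => M) :=
    integrable_of_bounded (measurable_hardCore _) (hardCore_nonneg _) (hardCore_le_one _)
  have hmE : MeasurableSet (Set.univ.pi fun _ : Fin (n + 1) => E) :=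
    MeasurableSet.univ_pi fun _ => hE
  have hmi : ∀ i : Fin (n + 1),
      MeasurableSet {x : Fin (n + 1) → X | x i ∈ A ∧ ∀ j, x (i.succAbove j) ∈ E} := fun i => by
    simp only [Set.ofPred_and, Set.ofPred_forall]
    exact (measurable_pi_apply i hA).inter
      (MeasurableSet.iInter fun j => measurable_pi_apply (i.succAbove j) hE)
  rw [hardCoreWeight, ← integral_indicator (MeasurableSet.univ_pi fun _ => hA.union hE)]
  simp only [hardCore_indicator_union hdiam hAE]
  rw [integral_add (hint.indicator hmE) (integrable_finsetSum _ fun i _ => hint.indicator (hmi i)),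
    integral_finsetSum _ fun i _ => hint.indicator (hmi i), integral_indicator hmE]
  simp [setIntegral_hardCore_insertNth M hA hE, hardCoreWeight]

lemma hasSum_integral_genZ {A E : Set X} (hA : MeasurableSet A) (hE : MeasurableSet E) :
    HasSum (fun n : ℕ => (-1 : ℝ) ^ n / n.factorial *
      ∫ y in A, hardCoreWeight M n (E \ ball y 1) ∂M) (∫ y in A, genZ (E \ ball y 1) M ∂M) := by
  simp only [← integral_const_mul]
  refine hasSum_integral_of_dominated_convergence
    (fun n _ => M.real Set.univ ^ n / n.factorial) (fun n => ?_) (fun n => ?_) ?_ ?_ ?_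
  · exact ((integrableOn_hardCoreWeight_avoiding M hA hE n).const_mul _).aestronglyMeasurable
  · exact Filter.Eventually.of_forall fun y => norm_term_le M n _
  · exact Filter.Eventually.of_forall fun y => Real.summable_pow_div_factorial _
  · exact integrable_const _
  · exact Filter.Eventually.of_forall fun y => hasSum_genZ M _

lemma integrableOn_genZ_avoiding {A E : Set X} (hA : MeasurableSet A) (hE : MeasurableSet E) :
    IntegrableOn (fun y => genZ (E \ ball y 1) M) A M := by
  have hmeas : AEStronglyMeasurable (fun y => genZ (E \ ball y 1) M) (M.restrict A) :=
    aestronglyMeasurable_of_tendsto_ae Filter.atTop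
      (f := fun (N : ℕ) y => ∑ n ∈ Finset.range N, (-1 : ℝ) ^ n / n.factorial *
        hardCoreWeight M n (E \ ball y 1))
      (fun N => (integrable_finsetSum _ fun n _ =>
        (integrableOn_hardCoreWeight_avoiding M hA hE n).const_mul _).aestronglyMeasurable)
      (Filter.Eventually.of_forall fun y => (hasSum_genZ M _).tendsto_sum_nat)
  refine Integrable.of_bound hmeas (∑' n : ℕ, M.real Set.univ ^ n / n.factorial)
    (Filter.Eventually.of_forall fun y => ?_)
  exact tsum_of_norm_bounded (Real.summable_pow_div_factorial _).hasSum fun n => norm_term_le M n _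

/-- The fundamental recursion of the generating function: adding a set of diameter less
than one. -/
lemma genZ_union {A E : Set X} (hA : MeasurableSet A) (hE : MeasurableSet E)
    (hdiam : ∀ x ∈ A, ∀ y ∈ A, dist x y < 1) (hAE : Disjoint A E) :
    genZ (A ∪ E) M = genZ E M - ∫ y in A, genZ (E \ ball y 1) M ∂M := by
  have h1 := (hasSum_nat_add_iff' 1).2 (hasSum_genZ M (A ∪ E))
  have h2 := (hasSum_nat_add_iff' 1).2 (hasSum_genZ M E)
  have h3 := h2.sub (hasSum_integral_genZ M hA hE)
  have h4 : ∀ n : ℕ, (-1 : ℝ) ^ (n + 1) / (n + 1).factorial * hardCoreWeight M (n + 1) (A ∪ E) =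
      (-1 : ℝ) ^ (n + 1) / (n + 1).factorial * hardCoreWeight M (n + 1) E -
      (-1 : ℝ) ^ n / n.factorial * ∫ y in A, hardCoreWeight M n (E \ ball y 1) ∂M := fun n => by
    rw [hardCoreWeight_union_succ M hA hE hdiam hAE, Nat.factorial_succ]
    push_cast
    have : (n.factorial : ℝ) ≠ 0 := by positivity
    have : (n : ℝ) + 1 ≠ 0 := by positivity
    field_simp
    ring
  simp only [h4] at h1
  have h5 := h1.unique h3
  have h6 : hardCoreWeight M 0 (A ∪ E) = hardCoreWeight M 0 E := by
    simp [hardCoreWeight, Set.pi]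
  simp only [Finset.sum_range_one, h6] at h5
  linarith

section Shearer

variable {M} {ι : Type*} {C : ι → Set X}

lemma genZ_anti (hsh : ∀ B, MeasurableSet B → 0 ≤ genZ B M)
    (hCm : ∀ i, MeasurableSet (C i)) (hCd : ∀ i, ∀ x ∈ C i, ∀ y ∈ C i, dist x y < 1)
    (s : Finset ι) {S T : Set X} (hS : MeasurableSet S) (hT : MeasurableSet T)
    (hST : S ⊆ T) (hTs : T \ S ⊆ ⋃ i ∈ s, C i) : genZ T M ≤ genZ S M := by
  classical
  induction s using Finset.induction_on generalizing S with
  | empty =>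
    have : T = S := hST.antisymm' (Set.sdiff_eq_empty.1 (by simpa using hTs))
    rw [this]
  | insert i s _ ih =>
    have hA : MeasurableSet ((T ∩ C i) \ S) := (hT.inter (hCm i)).diff hS
    refine (ih (S := ((T ∩ C i) \ S) ∪ S) (hA.union hS)
      (Set.union_subset (fun x hx => hx.1.1) hST) fun x hx => ?_).trans ?_
    · have := hTs ⟨hx.1, fun h => hx.2 (Or.inr h)⟩
      simp only [Finset.mem_insert, Set.iUnion_iUnion_eq_or_left] at this
      refine this.resolve_left fun h => hx.2 ?_
      exact (em (x ∈ S)).elim Or.inr fun h' => Or.inl ⟨⟨hx.1, h⟩, h'⟩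
    · rw [genZ_union M hA hS (fun x hx y hy => hCd i x hx.1.2 y hy.1.2) Set.disjoint_sdiff_left]
      have : 0 ≤ ∫ y in (T ∩ C i) \ S, genZ (S \ ball y 1) M ∂M :=
        integral_nonneg fun y => hsh _ (hS.diff measurableSet_ball)
      linarith

/-- One step of the submodularity induction: the added set lies in a single piece `C c`. -/
lemma genZ_ratio_anti_of_subset_piece (hsh : ∀ B, MeasurableSet B → 0 ≤ genZ B M)
    (hCm : ∀ i, MeasurableSet (C i)) (hCd : ∀ i, ∀ x ∈ C i, ∀ y ∈ C i, dist x y < 1)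
    (s : Finset ι) (c : ι)
    (ih : ∀ S T, MeasurableSet S → MeasurableSet T → S ⊆ ⋃ i ∈ s, C i → T ⊆ ⋃ i ∈ s, C i →
      genZ (S ∪ T) M * genZ (S ∩ T) M ≤ genZ S M * genZ T M)
    {A B B' : Set X} (hA : MeasurableSet A) (hB : MeasurableSet B) (hB' : MeasurableSet B')
    (hAc : A ⊆ C c) (hBB : B ⊆ B') (hAB : Disjoint A B')
    (hs : B' \ C c ⊆ ⋃ i ∈ s, C i) :
    genZ (A ∪ B') M * genZ B M ≤ genZ (A ∪ B) M * genZ B' M := by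
  have hEE : B \ C c ⊆ B' \ C c := Set.sdiff_subset_sdiff_left hBB
  have hE := hB.diff (hCm c)
  have hE' := hB'.diff (hCm c)
  -- the recursion applied to a subset of the piece
  have hexp : ∀ {D E : Set X}, MeasurableSet D → MeasurableSet E → D ⊆ C c → Disjoint (C c) E →
      genZ (D ∪ E) M = genZ E M - ∫ y in D, genZ (E \ ball y 1) M ∂M := fun hD hE hDc hcE =>
    genZ_union M hD hE (fun x hx y hy => hCd c x (hDc hx) y (hDc hy)) (hcE.mono_left hDc)
  have hsplit : ∀ {F : Set X}, MeasurableSet F → F ⊆ B' →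
      genZ F M = genZ (F \ C c) M - ∫ y in F ∩ C c, genZ ((F \ C c) \ ball y 1) M ∂M ∧
      genZ (A ∪ F) M = genZ (F \ C c) M - (∫ y in A, genZ ((F \ C c) \ ball y 1) M ∂M) -
        ∫ y in F ∩ C c, genZ ((F \ C c) \ ball y 1) M ∂M := fun {F} hF hFB => by
    have hD := hF.inter (hCm c)
    have hG := hF.diff (hCm c)
    constructor
    · rw [← hexp hD hG Set.inter_subset_right Set.disjoint_sdiff_right, Set.inter_union_sdiff]
    · have hdisj : Disjoint A (F ∩ C c) := hAB.mono_right (Set.inter_subset_left.trans hFB)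
      rw [sub_sub, ← setIntegral_union hdisj hD (integrableOn_genZ_avoiding M hA hG)
          (integrableOn_genZ_avoiding M hD hG),
        ← hexp (hA.union hD) hG (Set.union_subset hAc Set.inter_subset_right)
          Set.disjoint_sdiff_right, Set.union_assoc, Set.inter_union_sdiff]
  obtain ⟨e1, e2⟩ := hsplit hB hBB
  obtain ⟨e3, e4⟩ := hsplit hB' subset_rfl
  have hpt : ∀ y, genZ (B' \ C c) M * genZ ((B \ C c) \ ball y 1) M ≤
      genZ (B \ C c) M * genZ ((B' \ C c) \ ball y 1) M := fun y => by
    have hEb := hE'.diff (measurableSet_ball (x := y) (ε := 1))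
    have h := ih (B \ C c) ((B' \ C c) \ ball y 1) hE hEb (hEE.trans hs)
      (Set.sdiff_subset.trans hs)
    have hcap : (B \ C c) ∩ ((B' \ C c) \ ball y 1) = (B \ C c) \ ball y 1 := by
      rw [← Set.inter_sdiff_assoc, Set.inter_eq_left.2 hEE]
    rw [hcap] at h
    refine le_trans (mul_le_mul_of_nonneg_right ?_ (hsh _ (hE.diff measurableSet_ball))) h
    exact genZ_anti hsh hCm hCd s (hE.union hEb) hE' (Set.union_subset hEE Set.sdiff_subset)
      (Set.sdiff_subset.trans hs)
  have hint : ∀ {D : Set X}, MeasurableSet D →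
      genZ (B' \ C c) M * ∫ y in D, genZ ((B \ C c) \ ball y 1) M ∂M ≤
      genZ (B \ C c) M * ∫ y in D, genZ ((B' \ C c) \ ball y 1) M ∂M := fun hD => by
    rw [← integral_const_mul, ← integral_const_mul]
    exact integral_mono ((integrableOn_genZ_avoiding M hD hE).const_mul _)
      ((integrableOn_genZ_avoiding M hD hE').const_mul _) hpt
  have ha := hint hA
  have hd := hint (hB.inter (hCm c))
  have hd' : ∫ y in B ∩ C c, genZ ((B' \ C c) \ ball y 1) M ∂M ≤
      ∫ y in B' ∩ C c, genZ ((B' \ C c) \ ball y 1) M ∂M :=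
    setIntegral_mono_set (integrableOn_genZ_avoiding M (hB'.inter (hCm c)) hE')
      (Filter.Eventually.of_forall fun y => hsh _ (hE'.diff measurableSet_ball))
      (Set.inter_subset_inter_left _ hBB).eventuallyLE
  have hz' := hsh _ hB'
  have ha0 : 0 ≤ ∫ y in A, genZ ((B' \ C c) \ ball y 1) M ∂M :=
    integral_nonneg fun y => hsh _ (hE'.diff measurableSet_ball)
  have hz := hsh _ hE
  have hdd := mul_le_mul_of_nonneg_left hd' hz
  have hx := mul_le_mul_of_nonneg_right ha hz'
  have hy := mul_le_mul_of_nonneg_left (hd.trans hdd) ha0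
  rcases (hsh _ hE').eq_or_lt with h0 | hpos
  · have hAB0 : genZ (A ∪ B') M ≤ 0 := by
      have : 0 ≤ ∫ y in B' ∩ C c, genZ ((B' \ C c) \ ball y 1) M ∂M :=
        integral_nonneg fun y => hsh _ (hE'.diff measurableSet_ball)
      rw [e4, ← h0]
      linarith
    exact (mul_nonpos_of_nonpos_of_nonneg hAB0 (hsh _ hB)).trans
      (mul_nonneg (hsh _ (hA.union hB)) hz')
  · rw [e2, e4]
    rw [e3] at hx
    rw [e1, e3]
    refine le_of_mul_le_mul_left ?_ hpos
    nlinarith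

lemma genZ_submodular (hsh : ∀ B, MeasurableSet B → 0 ≤ genZ B M)
    (hCm : ∀ i, MeasurableSet (C i)) (hCd : ∀ i, ∀ x ∈ C i, ∀ y ∈ C i, dist x y < 1)
    (s : Finset ι) : ∀ S T, MeasurableSet S → MeasurableSet T →
    S ⊆ ⋃ i ∈ s, C i → T ⊆ ⋃ i ∈ s, C i →
    genZ (S ∪ T) M * genZ (S ∩ T) M ≤ genZ S M * genZ T M := by
  classical
  induction s using Finset.strongInduction with
  | H s ih =>
  -- adding to `B ⊆ B'` a set covered by the pieces indexed by `t ⊆ s`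
  have key : ∀ t : Finset ι, t ⊆ s → ∀ A B B' : Set X, MeasurableSet A → MeasurableSet B →
      MeasurableSet B' → B ⊆ B' → Disjoint A B' → A ⊆ ⋃ i ∈ t, C i → B' ⊆ ⋃ i ∈ s, C i →
      genZ (A ∪ B') M * genZ B M ≤ genZ (A ∪ B) M * genZ B' M := by
    intro t
    induction t using Finset.induction_on with
    | empty =>
      intro _ A B B' _ _ _ _ _ hA _
      have : A = ∅ := by simpa using hA
      simp [this, mul_comm]
    | insert c t _ iht =>
      intro hts A B B' hA hB hB' hBB hAB hAt hB's
      have hcs : c ∈ s := hts (Finset.mem_insert_self c t)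
      have hts' : t ⊆ s := (Finset.subset_insert c t).trans hts
      have hA0 := hA.diff (hCm c)
      have hA1 := hA.inter (hCm c)
      have hA0t : A \ C c ⊆ ⋃ i ∈ t, C i := fun x hx => by
        have := hAt hx.1
        simp only [Finset.mem_insert, Set.iUnion_iUnion_eq_or_left] at this
        exact this.resolve_left hx.2
      have hA0s : A \ C c ⊆ ⋃ i ∈ s, C i := hA0t.trans (Set.biUnion_subset_biUnion_left hts')
      have h1 := iht hts' (A \ C c) B B' hA0 hB hB' hBB (hAB.mono_left Set.sdiff_subset) hA0t hB's
      have h2 := genZ_ratio_anti_of_subset_piece hsh hCm hCd (s.erase c) c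
        (ih _ (Finset.erase_ssubset hcs)) hA1 (hA0.union hB) (hA0.union hB')
        Set.inter_subset_right (Set.union_subset_union_right _ hBB)
        (Set.disjoint_union_right.2
          ⟨Set.disjoint_sdiff_right.mono_left Set.inter_subset_right,
            hAB.mono_left Set.inter_subset_left⟩)
        (fun x hx => by
          have := Set.union_subset hA0s hB's hx.1
          simp only [Set.mem_iUnion, Finset.mem_erase] at this ⊢
          obtain ⟨i, hi, hxi⟩ := this
          exact ⟨i, ⟨fun h => hx.2 (h ▸ hxi), hi⟩, hxi⟩)
      rw [← Set.union_assoc, ← Set.union_assoc, Set.inter_union_sdiff] at h2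
      have hn1 := hsh _ (hA.union hB)
      have hn2 := hsh _ hB
      rcases (hsh _ (hA0.union hB)).eq_or_lt with h0 | hpos
      · have : genZ (A ∪ B') M ≤ 0 := by
          rw [h0]
          refine genZ_anti hsh hCm hCd s (hA0.union hB) (hA.union hB')
            (Set.union_subset_union Set.sdiff_subset hBB) (Set.sdiff_subset.trans ?_)
          exact Set.union_subset (hAt.trans (Set.biUnion_subset_biUnion_left hts)) hB's
        exact (mul_nonpos_of_nonpos_of_nonneg this hn2).trans (mul_nonneg hn1 (hsh _ hB'))
      · refine le_of_mul_le_mul_left ?_ hpos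
        have h3 := mul_le_mul_of_nonneg_right h2 hn2
        have h4 := mul_le_mul_of_nonneg_left h1 hn1
        linarith
  intro S T hS hT hSs hTs
  have h := key s subset_rfl (S \ T) (S ∩ T) T (hS.diff hT) (hS.inter hT) hT
    Set.inter_subset_right Set.disjoint_sdiff_left (Set.sdiff_subset.trans hSs) hTs
  rwa [Set.sdiff_union_self, Set.sdiff_union_inter] at h

end Shearer

end Finite

lemma exists_cover_of_kappa_lt_top {B : Set X} (h : kappa B < ⊤) :
    ∃ (m : ℕ) (C : Fin m → Set X), (∀ i, MeasurableSet (C i)) ∧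
      (∀ i, ∀ x ∈ C i, ∀ y ∈ C i, dist x y < 1) ∧ B = ⋃ i, C i := by
  obtain ⟨k, ⟨m, -, C, hCm, hCd, -, hB⟩, -⟩ := sInf_lt_iff.1 h
  refine ⟨m, C, hCm, fun i x hx y hy => ?_, hB⟩
  have := (Metric.edist_le_ediam_of_mem hx hy).trans_lt (hCd i)
  rwa [edist_dist, ENNReal.ofReal_lt_one] at this

end Aux

/-- Monotonicity of the ratio `z` in both arguments: if `M ∈ 𝓜^sh`, `A ⊆ A'`,
`B ⊆ B'`, `A ∩ B = A ∩ B'` are Borel sets of finite unit partition number with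
`Z(B, M) > 0` and `Z(B', M) > 0`, then
`Z(A ∪ B, M)/Z(B, M) ≥ Z(A' ∪ B', M)/Z(B', M)`. -/
theorem stmt19 {X : Type*} [MetricSpace X] [CompleteSpace X]
    [TopologicalSpace.SeparableSpace X] [MeasurableSpace X] [BorelSpace X]
    (M : Measure X) (hM : ∀ s : Set X, Bornology.IsBounded s → M s < ⊤)
    (hsh : ∀ B : Set X, MeasurableSet B → Bornology.IsBounded B → 0 ≤ genZ B M)
    (A A' B B' : Set X)
    (hAm : MeasurableSet A) (hA'm : MeasurableSet A')
    (hBm : MeasurableSet B) (hB'm : MeasurableSet B')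
    (hAk : kappa A < ⊤) (hA'k : kappa A' < ⊤)
    (hBk : kappa B < ⊤) (hB'k : kappa B' < ⊤)
    (hAA : A ⊆ A') (hBB : B ⊆ B') (hcap : A ∩ B = A ∩ B')
    (hZB : 0 < genZ B M) (hZB' : 0 < genZ B' M) :
    genZ (A' ∪ B') M / genZ B' M ≤ genZ (A ∪ B) M / genZ B M := by
  have : SecondCountableTopology X := UniformSpace.secondCountable_of_separable X
  have : IsLocallyFiniteMeasure M :=
    ⟨fun x => ⟨ball x 1, ball_mem_nhds x one_pos, hM _ isBounded_ball⟩⟩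
  obtain ⟨m, C, hCm, hCd, hC⟩ := exists_cover_of_kappa_lt_top hA'k
  obtain ⟨n, D, hDm, hDd, hD⟩ := exists_cover_of_kappa_lt_top hB'k
  let K : Fin m ⊕ Fin n → Set X := Sum.elim C D
  have hKm : ∀ i, MeasurableSet (K i) := by rintro (i | i); exacts [hCm i, hDm i]
  have hKd : ∀ i, ∀ x ∈ K i, ∀ y ∈ K i, dist x y < 1 := by
    rintro (i | i); exacts [hCd i, hDd i]
  have hK : A' ∪ B' = ⋃ i, K i := by rw [Set.iUnion_sum, hC, hD]; rfl
  have hW : MeasurableSet (A' ∪ B') := hA'm.union hB'm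
  have hWb : Bornology.IsBounded (A' ∪ B') := by
    rw [hK, Bornology.isBounded_iUnion]
    exact fun i => isBounded_iff.2 ⟨1, fun x hx y hy => (hKd i x hx y hy).le⟩
  have : IsFiniteMeasure (M.restrict (A' ∪ B')) := isFiniteMeasure_restrict.2 (hM _ hWb).ne
  have hres : ∀ {S : Set X}, MeasurableSet S → S ⊆ A' ∪ B' →
      genZ S (M.restrict (A' ∪ B')) = genZ S M := fun hS hSW => by
    rw [genZ_restrict M _ hS, Set.inter_eq_left.2 hSW]
  have hsh' : ∀ S, MeasurableSet S → 0 ≤ genZ S (M.restrict (A' ∪ B')) := fun S hS => by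
    rw [genZ_restrict M _ hS]
    exact hsh _ (hS.inter hW) (hWb.subset Set.inter_subset_right)
  have hK' : A' ∪ B' ⊆ ⋃ i ∈ Finset.univ, K i := by simp [← hK]
  have hAB : A ∪ B ⊆ A' ∪ B' := Set.union_subset_union hAA hBB
  have hAB' : A ∪ B' ⊆ A' ∪ B' := Set.union_subset_union_left _ hAA
  have hanti := genZ_anti hsh' hKm hKd Finset.univ (hAm.union hB'm) hW hAB'
    (Set.sdiff_subset.trans hK')
  have hsub := genZ_submodular hsh' hKm hKd Finset.univ (A ∪ B) B' (hAm.union hBm) hB'm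
    (hAB.trans hK') (Set.subset_union_right.trans hK')
  rw [Set.union_assoc, Set.union_eq_self_of_subset_left hBB, Set.union_inter_distrib_right,
    ← hcap, Set.inter_eq_left.2 hBB, Set.union_eq_self_of_subset_left Set.inter_subset_right,
    hres (hAm.union hB'm) hAB', hres hBm (hBB.trans Set.subset_union_right),
    hres (hAm.union hBm) hAB, hres hB'm Set.subset_union_right] at hsub
  rw [hres hW subset_rfl, hres (hAm.union hB'm) hAB'] at hanti
  rw [div_le_div_iff₀ hZB' hZB]
  exact (mul_le_mul_of_nonneg_right hanti hZB.le).trans hsub
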